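/- Let p ≥ 3 be odd and let q be an even positive integer dividing 2p. Then the group Γ(p,q), with its generating involutions ρ0, ρ1, ρ2, satisfies the intersection condition; moreover, the subgroup of Γ(p,q) generated by ρ0ρ1 and ρ1ρ2 has index 2. -/

import Mathlib

/-- The intersection condition for a group generated by `n` involutions. -/
def interCond {G : Type*} [Group G] {n : ℕ} (ρ : Fin n → G) : Prop :=
  ∀ I J : Set (Fin n),
    Subgroup.closure (ρ '' I) ⊓ Subgroup.closure (ρ '' J) = Subgroup.closure (ρ '' (I ∩ J))

/-- The defining relations of the group `Γ(p, q)`: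
`ρ0² = ρ1² = ρ2² = (ρ0ρ1)^p = (ρ1ρ2)^q = (ρ0ρ2)² = (ρ0ρ1ρ2ρ1ρ2)² = 1`. -/
def gamma2Rels (p q : ℕ) : Set (FreeGroup (Fin 3)) :=
  {(FreeGroup.of 0) ^ 2, (FreeGroup.of 1) ^ 2, (FreeGroup.of 2) ^ 2,
   (FreeGroup.of 0 * FreeGroup.of 1) ^ p, (FreeGroup.of 1 * FreeGroup.of 2) ^ q,
   (FreeGroup.of 0 * FreeGroup.of 2) ^ 2,
   (FreeGroup.of 0 * FreeGroup.of 1 * FreeGroup.of 2 * FreeGroup.of 1 * FreeGroup.of 2) ^ 2}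

/-- The group `Γ(p, q)`. -/
abbrev Gamma2 (p q : ℕ) : Type := PresentedGroup (gamma2Rels p q)

/-- The generator `ρ_i` of `Γ(p, q)`. -/
def rho (p q : ℕ) (i : Fin 3) : Gamma2 p q := PresentedGroup.of i

theorem mem_zpowers_of_sq_eq_one {G : Type*} [Group G] {g x : G} (hg : g ^ 2 = 1)
    (hx : x ∈ Subgroup.zpowers g) : x = 1 ∨ x = g := by
  obtain ⟨n, rfl⟩ := Subgroup.mem_zpowers_iff.mp hx
  have hg' : g ^ (2 : ℤ) = 1 := by exact_mod_cast hg
  rcases Int.even_or_odd' n with ⟨k, rfl | rfl⟩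
  · left
    rw [zpow_mul, hg', one_zpow]
  · right
    rw [zpow_add, zpow_mul, hg', one_zpow, one_mul, zpow_one]

theorem mem_closure_pair_of_sq_eq_one {G : Type*} [Group G] {a b x : G} (ha : a ^ 2 = 1)
    (hb : b ^ 2 = 1) (hx : x ∈ Subgroup.closure {a, b}) :
    x ∈ Subgroup.zpowers (a * b) ∨ x * b ∈ Subgroup.zpowers (a * b) := by
  rw [sq] at ha hb
  have ha' : a⁻¹ = a := inv_eq_of_mul_eq_one_left ha
  have hb' : b⁻¹ = b := inv_eq_of_mul_eq_one_left hb
  have hab : a * b ∈ Subgroup.zpowers (a * b) := Subgroup.mem_zpowers _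
  have hba : b * a ∈ Subgroup.zpowers (a * b) := by
    simpa [ha', hb'] using inv_mem hab
  have step : ∀ x s, s = a ∨ s = b →
      x ∈ Subgroup.zpowers (a * b) ∨ x * b ∈ Subgroup.zpowers (a * b) →
      x * s ∈ Subgroup.zpowers (a * b) ∨ x * s * b ∈ Subgroup.zpowers (a * b) := by
    rintro x s (rfl | rfl) (h | h)
    · exact Or.inr (by simpa [mul_assoc] using mul_mem h hab)
    · left
      have := mul_mem h hba
      rwa [mul_assoc, ← mul_assoc b b, hb, one_mul] at this
    · exact Or.inr (by rwa [mul_assoc, hb, mul_one])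
    · exact Or.inl h
  induction hx using Subgroup.closure_induction_right with
  | one => exact Or.inl (one_mem _)
  | mul_right x _ s hs ih => exact step x s hs ih
  | mul_inv_cancel x _ s hs ih =>
    have : s⁻¹ = s := by rcases hs with rfl | rfl <;> assumption
    rw [this]
    exact step x s hs ih

theorem sr_ne_one {n : ℕ} (i : ZMod n) : DihedralGroup.sr i ≠ 1 :=
  fun h => nomatch DihedralGroup.one_def ▸ h

theorem rel_eq_one {p q : ℕ} {w : FreeGroup (Fin 3)} (hw : w ∈ gamma2Rels p q) :
    PresentedGroup.mk (gamma2Rels p q) w = 1 :=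
  PresentedGroup.one_of_mem hw

theorem rho_sq (p q : ℕ) (i : Fin 3) : rho p q i ^ 2 = 1 := by
  have h : (FreeGroup.of i) ^ 2 ∈ gamma2Rels p q := by
    fin_cases i <;> simp [gamma2Rels]
  exact rel_eq_one h

theorem rho_zero_mul_one_pow (p q : ℕ) : (rho p q 0 * rho p q 1) ^ p = 1 := by
  have h : (FreeGroup.of 0 * FreeGroup.of 1) ^ p ∈ gamma2Rels p q := by
    simp [gamma2Rels]
  exact rel_eq_one h

theorem rho_zero_mul_two_sq (p q : ℕ) : (rho p q 0 * rho p q 2) ^ 2 = 1 := by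
  have h : (FreeGroup.of 0 * FreeGroup.of 2) ^ 2 ∈ gamma2Rels p q := by
    simp [gamma2Rels]
  exact rel_eq_one h

theorem closure_range_rho (p q : ℕ) : Subgroup.closure (Set.range (rho p q)) = ⊤ :=
  PresentedGroup.closure_range_of _

/-- The homomorphism from `Γ(p, q)` onto the dihedral group of order `2 * p` that kills `ρ2`. -/
def toDihedral (p q : ℕ) (hq : Even q) : Gamma2 p q →* DihedralGroup p :=
  PresentedGroup.toGroup (f := ![.sr 0, .sr 1, 1]) (by
    obtain ⟨k, rfl⟩ := hq
    intro r hr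
    simp only [gamma2Rels, Set.mem_insert_iff, Set.mem_singleton_iff] at hr
    rcases hr with rfl | rfl | rfl | rfl | rfl | rfl | rfl <;>
      simp [sq, ← two_mul, pow_mul])

/-- The homomorphism from `Γ(p, q)` to `ℤˣ` that sends `ρ2` to `-1` and kills `ρ0` and `ρ1`. -/
def parityTwo (p q : ℕ) (hq : Even q) : Gamma2 p q →* ℤˣ :=
  PresentedGroup.toGroup (f := ![1, 1, -1]) (by
    intro r hr
    simp only [gamma2Rels, Set.mem_insert_iff, Set.mem_singleton_iff] at hr
    rcases hr with rfl | rfl | rfl | rfl | rfl | rfl | rfl <;> simp [hq])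

/-- The homomorphism from `Γ(p, q)` to `ℤˣ` that sends every generator to `-1`. -/
def parity (p q : ℕ) : Gamma2 p q →* ℤˣ :=
  PresentedGroup.toGroup (f := fun _ => -1) (by
    intro r hr
    simp only [gamma2Rels, Set.mem_insert_iff, Set.mem_singleton_iff] at hr
    rcases hr with rfl | rfl | rfl | rfl | rfl | rfl | rfl <;> simp)

theorem toDihedral_rho (p q : ℕ) (hq : Even q) (i : Fin 3) :
    toDihedral p q hq (rho p q i) = (![.sr 0, .sr 1, 1] : Fin 3 → DihedralGroup p) i :=
  PresentedGroup.toGroup.of _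

theorem parityTwo_rho (p q : ℕ) (hq : Even q) (i : Fin 3) :
    parityTwo p q hq (rho p q i) = (![1, 1, -1] : Fin 3 → ℤˣ) i :=
  PresentedGroup.toGroup.of _

theorem parity_rho (p q : ℕ) (i : Fin 3) : parity p q (rho p q i) = -1 :=
  PresentedGroup.toGroup.of _

theorem rho_injective (p q : ℕ) (hp : p ≠ 1) (hq : Even q) : Function.Injective (rho p q) := by
  have : Nontrivial (ZMod p) := ZMod.nontrivial_iff.mpr hp
  intro i j h
  have h1 := congrArg (toDihedral p q hq) h
  have h2 := congrArg (parityTwo p q hq) h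
  rw [toDihedral_rho, toDihedral_rho] at h1
  rw [parityTwo_rho, parityTwo_rho] at h2
  fin_cases i <;> fin_cases j <;>
    simp [sr_ne_one, (sr_ne_one _).symm] at h1 h2 ⊢

theorem parityTwo_of_mem_closure {p q : ℕ} (hq : Even q) {x : Gamma2 p q}
    (hx : x ∈ Subgroup.closure {rho p q 0, rho p q 1}) : parityTwo p q hq x = 1 := by
  have : Subgroup.closure {rho p q 0, rho p q 1} ≤ (parityTwo p q hq).ker := by
    rw [Subgroup.closure_le]
    rintro _ (rfl | rfl) <;> exact parityTwo_rho p q hq _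
  exact this hx

theorem toDihedral_of_mem_closure {p q : ℕ} (hq : Even q) {x : Gamma2 p q}
    (hx : x ∈ Subgroup.closure {rho p q 1, rho p q 2}) :
    toDihedral p q hq x = 1 ∨ toDihedral p q hq x = .sr 1 := by
  have : Subgroup.closure {rho p q 1, rho p q 2} ≤
      (Subgroup.zpowers (DihedralGroup.sr 1)).comap (toDihedral p q hq) := by
    rw [Subgroup.closure_le]
    rintro _ (rfl | rfl)
    · rw [SetLike.mem_coe, Subgroup.mem_comap, toDihedral_rho]
      exact Subgroup.mem_zpowers _
    · rw [SetLike.mem_coe, Subgroup.mem_comap, toDihedral_rho]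
      exact one_mem _
  exact mem_zpowers_of_sq_eq_one (by simp [sq]) (this hx)

theorem eq_of_mem_closure_zero_two {p q : ℕ} {x : Gamma2 p q}
    (hx : x ∈ Subgroup.closure {rho p q 0, rho p q 2}) :
    x = 1 ∨ x = rho p q 0 ∨ x = rho p q 2 ∨ x = rho p q 0 * rho p q 2 := by
  have h2 : rho p q 2 * rho p q 2 = 1 := by rw [← sq, rho_sq]
  rcases mem_closure_pair_of_sq_eq_one (rho_sq p q 0) (rho_sq p q 2) hx with h | h <;>
    rcases mem_zpowers_of_sq_eq_one (rho_zero_mul_two_sq p q) h with h | h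
  · exact Or.inl h
  · exact Or.inr (Or.inr (Or.inr h))
  · exact Or.inr (Or.inr (Or.inl (mul_right_cancel (h.trans h2.symm))))
  · exact Or.inr (Or.inl (mul_right_cancel h))

theorem toDihedral_eq_one_of_mem_zpowers {p q : ℕ} (hq : Even q) {x : Gamma2 p q}
    (hx : x ∈ Subgroup.zpowers (rho p q 0 * rho p q 1))
    (h : toDihedral p q hq x = 1 ∨ ∃ k, toDihedral p q hq x = .sr k) : x = 1 := by
  obtain ⟨n, rfl⟩ := Subgroup.mem_zpowers_iff.mp hx
  have hr : toDihedral p q hq ((rho p q 0 * rho p q 1) ^ n) = .r (n : ZMod p) := by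
    simp [map_zpow, toDihedral_rho]
  rw [hr] at h
  rcases h with h | ⟨k, h⟩
  · rw [DihedralGroup.one_def, DihedralGroup.r.injEq, ZMod.intCast_zmod_eq_zero_iff_dvd] at h
    obtain ⟨m, rfl⟩ := h
    rw [zpow_mul, zpow_natCast, rho_zero_mul_one_pow, one_zpow]
  · cases h

theorem eq_one_or_eq_rho_one {p q : ℕ} (hq : Even q) {x : Gamma2 p q}
    (hx : x ∈ Subgroup.closure {rho p q 0, rho p q 1})
    (hy : x ∈ Subgroup.closure {rho p q 1, rho p q 2}) : x = 1 ∨ x = rho p q 1 := by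
  have h1 : rho p q 1 * rho p q 1 = 1 := by rw [← sq, rho_sq]
  have hd : ∀ {y : Gamma2 p q}, y ∈ Subgroup.closure {rho p q 1, rho p q 2} →
      y ∈ Subgroup.zpowers (rho p q 0 * rho p q 1) → y = 1 := fun h hz =>
    toDihedral_eq_one_of_mem_zpowers hq hz
      ((toDihedral_of_mem_closure hq h).imp id fun h => ⟨_, h⟩)
  rcases mem_closure_pair_of_sq_eq_one (rho_sq p q 0) (rho_sq p q 1) hx with h | h
  · exact Or.inl (hd hy h)
  · exact Or.inr (mul_right_cancel
      ((hd (mul_mem hy (Subgroup.subset_closure (by simp))) h).trans h1.symm))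

theorem eq_one_or_eq_rho_zero {p q : ℕ} (hq : Even q) {x : Gamma2 p q}
    (hx : x ∈ Subgroup.closure {rho p q 0, rho p q 1})
    (hy : x ∈ Subgroup.closure {rho p q 0, rho p q 2}) : x = 1 ∨ x = rho p q 0 := by
  have h := parityTwo_of_mem_closure hq hx
  rcases eq_of_mem_closure_zero_two hy with rfl | rfl | rfl | rfl
  · exact Or.inl rfl
  · exact Or.inr rfl
  · simp [parityTwo_rho] at h
  · simp [parityTwo_rho] at h

theorem eq_one_or_eq_rho_two {p q : ℕ} (hp : p ≠ 1) (hq : Even q) {x : Gamma2 p q}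
    (hx : x ∈ Subgroup.closure {rho p q 0, rho p q 2})
    (hy : x ∈ Subgroup.closure {rho p q 1, rho p q 2}) : x = 1 ∨ x = rho p q 2 := by
  have : Nontrivial (ZMod p) := ZMod.nontrivial_iff.mpr hp
  have h := toDihedral_of_mem_closure hq hy
  rcases eq_of_mem_closure_zero_two hx with rfl | rfl | rfl | rfl
  · exact Or.inl rfl
  · simp [toDihedral_rho, sr_ne_one] at h
  · exact Or.inr rfl
  · simp [toDihedral_rho, sr_ne_one] at h

theorem eq_one_or_eq_rho_of_mem_closure {p q : ℕ} (hp : p ≠ 1) (hq : Even q) {i j k : Fin 3}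
    (hij : i ≠ j) (hik : i ≠ k) (hjk : j ≠ k) {x : Gamma2 p q}
    (hx : x ∈ Subgroup.closure {rho p q i, rho p q k})
    (hy : x ∈ Subgroup.closure {rho p q j, rho p q k}) : x = 1 ∨ x = rho p q k := by
  wlog h : i < j generalizing i j
  · exact this hij.symm hjk hik hy hx (by omega)
  obtain ⟨rfl, rfl, rfl⟩ | ⟨rfl, rfl, rfl⟩ | ⟨rfl, rfl, rfl⟩ :
      (i = 0 ∧ j = 1 ∧ k = 2) ∨ (i = 0 ∧ j = 2 ∧ k = 1) ∨ (i = 1 ∧ j = 2 ∧ k = 0) := by omega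
  · exact eq_one_or_eq_rho_two hp hq hx hy
  · rw [Set.pair_comm (rho p q 2)] at hy
    exact eq_one_or_eq_rho_one hq hx hy
  · rw [Set.pair_comm] at hx hy
    exact eq_one_or_eq_rho_zero hq hx hy

theorem interCond_rho {p q : ℕ} (hp : p ≠ 1) (hq : Even q) : interCond (rho p q) := by
  have single : ∀ {I : Set (Fin 3)} {i k : Fin 3} {x : Gamma2 p q}, I ⊆ {i, k} → k ∉ I → i ≠ k →
      x ∈ Subgroup.closure (rho p q '' I) → x = rho p q k → x = 1 := by
    intro I i k x hI hk hik hx hxk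
    have hI' : I ⊆ {i} := fun l hl => (hI hl).resolve_right fun h => hk (h ▸ hl)
    have hx' : x ∈ Subgroup.zpowers (rho p q i) := by
      rw [Subgroup.zpowers_eq_closure, ← Set.image_singleton]
      exact Subgroup.closure_mono (Set.image_mono hI') hx
    refine (mem_zpowers_of_sq_eq_one (rho_sq p q i) hx').resolve_right fun h => hik ?_
    exact rho_injective p q hp hq (h.symm.trans hxk)
  intro I J
  refine le_antisymm ?_ (le_inf (Subgroup.closure_mono (Set.image_mono Set.inter_subset_left))
    (Subgroup.closure_mono (Set.image_mono Set.inter_subset_right)))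
  by_cases hIJ : I ⊆ J
  · rw [Set.inter_eq_left.mpr hIJ]
    exact inf_le_left
  by_cases hJI : J ⊆ I
  · rw [Set.inter_eq_right.mpr hJI]
    exact inf_le_right
  obtain ⟨i, hiI, hiJ⟩ := Set.not_subset.mp hIJ
  obtain ⟨j, hjJ, hjI⟩ := Set.not_subset.mp hJI
  have hij : i ≠ j := fun h => hiJ (h ▸ hjJ)
  obtain ⟨k, hik, hjk⟩ : ∃ k, i ≠ k ∧ j ≠ k := by
    clear hiI hiJ hjJ hjI
    decide +revert
  have third : ∀ l, l = i ∨ l = j ∨ l = k := by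
    intro l
    omega
  have hI : I ⊆ {i, k} := fun l hl => (third l).imp id fun h => h.resolve_left fun h => hjI (h ▸ hl)
  have hJ : J ⊆ {j, k} := fun l hl => (third l).resolve_left fun h => hiJ (h ▸ hl)
  rintro x ⟨hxI, hxJ⟩
  have hx : x = 1 ∨ x = rho p q k := by
    refine eq_one_or_eq_rho_of_mem_closure hp hq hij hik hjk ?_ ?_
    · rw [← Set.image_pair]
      exact Subgroup.closure_mono (Set.image_mono hI) hxI
    · rw [← Set.image_pair]
      exact Subgroup.closure_mono (Set.image_mono hJ) hxJ
  rcases hx with rfl | hx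
  · exact one_mem _
  by_cases hkI : k ∈ I
  · by_cases hkJ : k ∈ J
    · rw [hx]
      exact Subgroup.subset_closure ⟨k, ⟨hkI, hkJ⟩, rfl⟩
    · rw [single hJ hkJ hjk hxJ hx]
      exact one_mem _
  · rw [single hI hkI hik hxI hx]
    exact one_mem _

theorem index_closure_rotations (p q : ℕ) :
    (Subgroup.closure
      ({rho p q 0 * rho p q 1, rho p q 1 * rho p q 2} : Set (Gamma2 p q))).index = 2 := by
  set H := Subgroup.closure
    ({rho p q 0 * rho p q 1, rho p q 1 * rho p q 2} : Set (Gamma2 p q)) with hH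
  have hinv : ∀ i, (rho p q i)⁻¹ = rho p q i := fun i =>
    inv_eq_of_mul_eq_one_left (by rw [← sq, rho_sq])
  have hself : ∀ i, rho p q i * rho p q i = 1 := fun i => by rw [← sq, rho_sq]
  have h01 : rho p q 0 * rho p q 1 ∈ H := Subgroup.subset_closure (by simp)
  have h12 : rho p q 1 * rho p q 2 ∈ H := Subgroup.subset_closure (by simp)
  have hl : ∀ i, rho p q 0 * rho p q i ∈ H := by
    intro i
    fin_cases i
    · exact (hself 0).symm ▸ one_mem H
    · exact h01
    · have := mul_mem h01 h12
      rwa [mul_assoc, ← mul_assoc (rho p q 1), hself, one_mul] at this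
  have hr : ∀ i, rho p q i * rho p q 0 ∈ H := by
    intro i
    simpa [hinv] using inv_mem (hl i)
  have hker : H ≤ (parity p q).ker := by
    rw [hH, Subgroup.closure_le]
    rintro _ (rfl | rfl) <;> simp [MonoidHom.mem_ker, parity_rho]
  have step : ∀ x i, x * rho p q 0 ∈ H ∨ x ∈ H →
      x * rho p q i * rho p q 0 ∈ H ∨ x * rho p q i ∈ H := by
    rintro x i (h | h)
    · right
      have := mul_mem h (hl i)
      rwa [mul_assoc, ← mul_assoc (rho p q 0), hself, one_mul] at this
    · left
      rw [mul_assoc]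
      exact mul_mem h (hr i)
  refine Subgroup.index_eq_two_iff.mpr ⟨rho p q 0, fun x => ?_⟩
  have hor : x * rho p q 0 ∈ H ∨ x ∈ H := by
    have hx : x ∈ Subgroup.closure (Set.range (rho p q)) := by
      rw [closure_range_rho]
      trivial
    induction hx using Subgroup.closure_induction_right with
    | one => exact Or.inr (one_mem H)
    | mul_right x _ s hs ih =>
      obtain ⟨i, rfl⟩ := hs
      exact step x i ih
    | mul_inv_cancel x _ s hs ih =>
      obtain ⟨i, rfl⟩ := hs
      rw [hinv]
      exact step x i ih
  refine (xor_iff_or_and_not_and _ _).mpr ⟨hor, fun ⟨h1, h2⟩ => ?_⟩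
  have h1' := MonoidHom.mem_ker.mp (hker h1)
  rw [map_mul, MonoidHom.mem_ker.mp (hker h2), parity_rho] at h1'
  exact absurd h1' (by decide)


/-- If `p ≥ 3` is odd and `q` is an even positive integer dividing `2p`, then `Γ(p,q)` with its
generating involutions `ρ0, ρ1, ρ2` satisfies the intersection condition, and the subgroup
generated by `ρ0ρ1` and `ρ1ρ2` has index 2. -/
theorem gamma_pq_string_C_group (p q : ℕ) (hp3 : 3 ≤ p) (hpodd : Odd p)
    (hq0 : 0 < q) (hqeven : Even q) (hqdvd : q ∣ 2 * p) :
    interCond (rho p q) ∧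
    (Subgroup.closure
      ({rho p q 0 * rho p q 1, rho p q 1 * rho p q 2} : Set (Gamma2 p q))).index = 2 := by
  exact ⟨interCond_rho (by omega) hqeven, index_closure_rotations p q⟩
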